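/- For every integer n ≥ 2 and all indices with 1 ≤ j ≤ i ≤ n−1, 1 ≤ l ≤ k ≤ n−1, j+2 ≤ k, i ≥ k and j ≥ l, the equation h^{[i,j]} h^{[k,l]} = h^{[k−2,l]} h^{[i,j+2]} holds in the Kauffman monoid K_n. -/

import Mathlib

/-!
Kauffman monoid `K n` for `n ≥ 2`: presented by generators `h^1, …, h^{n-1}`
(diapsides) and `c` (circle), subject to
`h^i h^j = h^j h^i` for `|i-j| ≥ 2`, `h^i h^{i±1} h^i = h^i`,
`h^i c = c h^i`, `h^i h^i = c h^i`.
-/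

namespace Kauffman

/-- Valid diapsis indices `1 ≤ i ≤ n-1`. -/
def Idx (n : ℕ) : Type := {i : ℕ // 1 ≤ i ∧ i ≤ n - 1}

/-- Generators of the Kauffman monoid. -/
inductive Gen (n : ℕ) : Type
  | h : Idx n → Gen n
  | c : Gen n

/-- The defining relations of the Kauffman monoid. -/
inductive Rel (n : ℕ) : FreeMonoid (Gen n) → FreeMonoid (Gen n) → Prop
  | comm (i j : Idx n) (hij : i.1 + 2 ≤ j.1 ∨ j.1 + 2 ≤ i.1) :
      Rel n (FreeMonoid.of (Gen.h i) * FreeMonoid.of (Gen.h j))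
            (FreeMonoid.of (Gen.h j) * FreeMonoid.of (Gen.h i))
  | absorb (i j : Idx n) (hij : j.1 = i.1 + 1 ∨ i.1 = j.1 + 1) :
      Rel n (FreeMonoid.of (Gen.h i) * FreeMonoid.of (Gen.h j) * FreeMonoid.of (Gen.h i))
            (FreeMonoid.of (Gen.h i))
  | hc (i : Idx n) :
      Rel n (FreeMonoid.of (Gen.h i) * FreeMonoid.of Gen.c)
            (FreeMonoid.of Gen.c * FreeMonoid.of (Gen.h i))
  | hh (i : Idx n) :
      Rel n (FreeMonoid.of (Gen.h i) * FreeMonoid.of (Gen.h i))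
            (FreeMonoid.of Gen.c * FreeMonoid.of (Gen.h i))

/-- The congruence generated by the Kauffman relations. -/
def kcon (n : ℕ) : Con (FreeMonoid (Gen n)) := conGen (Rel n)

/-- The Kauffman monoid `K n`. -/
abbrev K (n : ℕ) : Type := (kcon n).Quotient

/-- The diapsis `h^i` as an element of `K n` (defined to be `1` for out-of-range `i`). -/
def hK (n i : ℕ) : K n :=
  if h : 1 ≤ i ∧ i ≤ n - 1 then ((FreeMonoid.of (Gen.h ⟨i, h⟩) : FreeMonoid (Gen n)) : K n)
  else 1

/-- The circle `c` as an element of `K n`. -/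
def cK (n : ℕ) : K n := ((FreeMonoid.of Gen.c : FreeMonoid (Gen n)) : K n)

/-- The block `h^{[i,j]} = h^i h^{i-1} ⋯ h^{j+1} h^j` (for `j ≤ i`). -/
def block (n i j : ℕ) : K n :=
  (((List.range (i + 1 - j)).map fun t => hK n (i - t))).prod

end Kauffman

namespace Kauffman

theorem hK_commute (n : ℕ) {i j : ℕ} (hij : i + 2 ≤ j) : Commute (hK n i) (hK n j) := by
  unfold hK
  split_ifs with h₁ h₂
  · exact (Con.eq (kcon n)).2 (ConGen.Rel.of _ _ (Rel.comm ⟨i, h₁⟩ ⟨j, h₂⟩ (Or.inl hij)))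
  · exact Commute.one_right _
  · exact Commute.one_left _
  · exact Commute.one_left _

theorem hK_absorb {n i j : ℕ} (hi : 1 ≤ i ∧ i ≤ n - 1) (hj : 1 ≤ j ∧ j ≤ n - 1)
    (hij : j = i + 1 ∨ i = j + 1) : hK n i * hK n j * hK n i = hK n i := by
  simp only [hK, dif_pos hi, dif_pos hj]
  exact (Con.eq (kcon n)).2 (ConGen.Rel.of _ _ (Rel.absorb ⟨i, hi⟩ ⟨j, hj⟩ hij))

theorem block_self (n i : ℕ) : block n i i = hK n i := by
  simp [block]

theorem block_split (n : ℕ) {i m j : ℕ} (hj : j ≤ m + 1) (hm : m ≤ i) :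
    block n i j = block n i (m + 1) * block n m j := by
  unfold block
  rw [show i + 1 - j = (i + 1 - (m + 1)) + (m + 1 - j) by omega, List.range_add, List.map_append,
    List.prod_append, List.map_map]
  congr 3
  funext t
  simp only [Function.comp_apply]
  congr 1
  omega

theorem block_commute (n : ℕ) {a b c d : ℕ} (h : a + 2 ≤ d) :
    Commute (block n a b) (block n c d) := by
  unfold block
  refine Commute.list_prod_left _ _ fun x hx => Commute.list_prod_right _ _ fun y hy => ?_
  simp only [List.mem_map, List.mem_range] at hx hy
  obtain ⟨s, hs, rfl⟩ := hx
  obtain ⟨t, ht, rfl⟩ := hy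
  exact hK_commute n (by omega)

theorem block_mul_hK {n i j q : ℕ} (hj : j ≤ q) (hq : q + 2 ≤ i) (hi : i ≤ n - 1) :
    block n i j * hK n (q + 2) = block n q j * block n i (q + 2) := by
  have hcomm : block n q j * hK n (q + 2) = hK n (q + 2) * block n q j := by
    rw [← block_self]
    exact block_commute n le_rfl
  rw [block_commute n (le_refl (q + 2)), block_split n (show j ≤ q + 2 + 1 by omega) hq,
    block_split n (show j ≤ q + 1 + 1 by omega) (Nat.le_succ (q + 1)),
    block_split n (show j ≤ q + 1 by omega) (Nat.le_succ q),
    block_split n (show q + 2 ≤ q + 2 + 1 by omega) hq, block_self, block_self]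
  calc _ = block n i (q + 2 + 1) * (hK n (q + 2) * hK n (q + 1) *
        (block n q j * hK n (q + 2))) := by simp only [mul_assoc]
    _ = block n i (q + 2 + 1) * (hK n (q + 2) * hK n (q + 1) * hK n (q + 2) * block n q j) := by
      rw [hcomm]; simp only [mul_assoc]
    _ = _ := by
      rw [hK_absorb (by omega) (by omega) (by omega)]; simp only [mul_assoc]

theorem hK_mul_block {n i p l : ℕ} (hl : 1 ≤ l) (hlp : l ≤ p) (hp : p + 2 ≤ i)
    (hi : i ≤ n - 1) : hK n p * block n i l = block n p l * block n i (p + 2) := by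
  obtain ⟨r, rfl⟩ : ∃ r, p = r + 1 := ⟨p - 1, by omega⟩
  have hcomm : hK n (r + 1) * block n i (r + 1 + 2) = block n i (r + 1 + 2) * hK n (r + 1) := by
    rw [← block_self]
    exact block_commute n le_rfl
  rw [block_commute n (le_refl (r + 1 + 2)),
    block_split n (show l ≤ r + 2 + 1 by omega) (show r + 2 ≤ i by omega),
    block_split n (show l ≤ r + 1 + 1 by omega) (Nat.le_succ (r + 1)),
    block_split n hlp (Nat.le_succ r), block_self, block_self]
  calc _ = hK n (r + 1) * block n i (r + 1 + 2) * (hK n (r + 2) * hK n (r + 1) *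
        block n r l) := by simp only [mul_assoc]
    _ = block n i (r + 1 + 2) * (hK n (r + 1) * hK n (r + 2) * hK n (r + 1) * block n r l) := by
      rw [hcomm]; simp only [mul_assoc]
    _ = _ := by
      rw [hK_absorb (by omega) (by omega) (by omega)]

end Kauffman

open Kauffman in
/-- `(h III.1)`: for `j+2 ≤ k`, `i ≥ k` and `j ≥ l`,
`h^{[i,j]} h^{[k,l]} = h^{[k-2,l]} h^{[i,j+2]}` in `K n`. -/
theorem kauffman_block_exchange_one (n i j k l : ℕ) (hn : 2 ≤ n)
    (hj : 1 ≤ j) (hji : j ≤ i) (hi : i ≤ n - 1)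
    (hl : 1 ≤ l) (hlk : l ≤ k) (hk : k ≤ n - 1)
    (hjk : j + 2 ≤ k) (hik : k ≤ i) (hjl : l ≤ j) :
    block n i j * block n k l = block n (k - 2) l * block n i (j + 2) := by
  obtain ⟨q, rfl⟩ : ∃ q, k = q + 2 := ⟨k - 2, by omega⟩
  obtain ⟨r, rfl⟩ : ∃ r, j = r + 1 := ⟨j - 1, by omega⟩
  rw [Nat.add_sub_cancel]
  calc block n i (r + 1) * block n (q + 2) l
      = block n i (r + 1) * hK n (q + 2) * block n (q + 1) l := by
        rw [block_split n (show l ≤ q + 1 + 1 by omega) (Nat.le_succ (q + 1)), block_self, mul_assoc]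
    _ = block n q (r + 1) * block n i l := by
        rw [block_mul_hK (by omega) hik hi, mul_assoc,
          ← block_split n (show l ≤ q + 1 + 1 by omega) (show q + 1 ≤ i by omega)]
    _ = block n q (r + 1 + 1) * (hK n (r + 1) * block n i l) := by
        rw [block_split n (show r + 1 ≤ r + 1 + 1 by omega) (show r + 1 ≤ q by omega), block_self,
          mul_assoc]
    _ = block n q l * block n i (r + 1 + 2) := by
        rw [hK_mul_block hl hjl (by omega) hi, ← mul_assoc,
          ← block_split n (show l ≤ r + 1 + 1 by omega) (show r + 1 ≤ q by omega)]
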